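/- Let X be a nonempty shift of finite type with entropy h(X) = log λ. For each n, let ℰ_n ⊆ Ω_n be the event that the random SFT X_ω is empty. Then for every α ∈ [0,1]: if α ∈ [0, 1/λ) then lim_{n→∞} ℙ(ℰ_n) = (ζ_X(α))^{-1}, and if α ∈ [1/λ, 1] then lim_{n→∞} ℙ(ℰ_n) = 0. -/

import Mathlib

open Filter Topology
open scoped Classical

noncomputable section

variable {A : Type*}

/-- The left shift map on bi-infinite sequences over the alphabet `A`. -/
def shiftMap (x : ℤ → A) : ℤ → A := fun i => x (i + 1)

/-- The word `w` of length `n` occurs in the bi-infinite sequence `x`. -/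
def OccursIn {n : ℕ} (w : Fin n → A) (x : ℤ → A) : Prop :=
  ∃ i : ℤ, ∀ j : Fin n, x (i + ((j : ℕ) : ℤ)) = w j

/-- `X` is a shift of finite type: the set of bi-infinite sequences avoiding a
finite set `F` of forbidden words. -/
def IsSFT (X : Set (ℤ → A)) : Prop :=
  ∃ F : Set ((n : ℕ) × (Fin n → A)), F.Finite ∧
    X = {x | ∀ w ∈ F, ¬ OccursIn w.2 x}

/-- `B_n(X)`: the set of words of length `n` appearing in points of `X`. -/
def wordsOf (X : Set (ℤ → A)) (n : ℕ) : Set (Fin n → A) :=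
  {w | ∃ x ∈ X, OccursIn w x}

/-- The length-`n` subword of `x` starting at position `i`. -/
def subword (x : ℤ → A) (i : ℤ) (n : ℕ) : Fin n → A :=
  fun j => x (i + ((j : ℕ) : ℤ))

/-- The random SFT `X_ω`: points of `X` all of whose length-`n` subwords are
allowed by `ω` (a word `w` is allowed iff `ω w = true`). -/
def XRes (X : Set (ℤ → A)) {n : ℕ} (ω : (Fin n → A) → Bool) : Set (ℤ → A) :=
  {x | x ∈ X ∧ ∀ i : ℤ, ω (subword x i n) = true}

/-- The probability of the event `Ev` when each coordinate in `E` is chosen to be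
`true` independently with probability `α` (i.i.d. Bernoulli(α) coins). -/
def bprob {E : Type*} [Fintype E] [DecidableEq E] (α : ℝ) (Ev : Set (E → Bool)) : ℝ :=
  ∑ ω : E → Bool,
    if ω ∈ Ev then
      α ^ (Finset.univ.filter fun e => ω e = true).card *
        (1 - α) ^ (Finset.univ.filter fun e => ω e = false).card
    else 0

/-- `N_p`: the number of points of `X` fixed by the `p`-th power of the shift. -/
def periodicCount (X : Set (ℤ → A)) (p : ℕ) : ℕ :=
  Nat.card {x : ℤ → A // x ∈ X ∧ shiftMap^[p] x = x}

/-- The Artin–Mazur zeta function `ζ_X(t) = exp (∑_{p ≥ 1} N_p t^p / p)`. -/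
def zetaX (X : Set (ℤ → A)) (t : ℝ) : ℝ :=
  Real.exp (∑' p : ℕ, (periodicCount X (p + 1) : ℝ) / (p + 1) * t ^ (p + 1))

end

theorem bprob_eq_sum_prod {E : Type*} [Fintype E] [DecidableEq E] (α : ℝ) (Ev : Set (E → Bool)) :
    bprob α Ev = ∑ ω : E → Bool,
      (∏ e, if ω e = true then α else 1 - α) * Ev.indicator (fun _ => (1 : ℝ)) ω := by
  unfold bprob
  refine Finset.sum_congr rfl fun ω _ => ?_
  rw [Finset.prod_ite]
  by_cases h : ω ∈ Ev
  · simp [h, Finset.prod_const]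
  · simp [h]

theorem bernoulliWeight_nonneg {E : Type*} [Fintype E] {α : ℝ} (h0 : 0 ≤ α) (h1 : α ≤ 1)
    (ω : E → Bool) : 0 ≤ ∏ e, if ω e = true then α else 1 - α :=
  Finset.prod_nonneg fun e _ => by split_ifs <;> linarith

theorem sum_bernoulliWeight_mul_forall {E : Type*} [Fintype E] [DecidableEq E] (α : ℝ)
    (W : Finset E) :
    ∑ ω : E → Bool, (∏ e, if ω e = true then α else 1 - α) *
      (if ∀ e ∈ W, ω e = true then (1 : ℝ) else 0) = α ^ W.card := by
  have key : ∀ ω : E → Bool, (∏ e, if ω e = true then α else 1 - α) *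
      (if ∀ e ∈ W, ω e = true then (1 : ℝ) else 0) =
      ∏ e, ((if ω e = true then α else 1 - α) * (if e ∈ W → ω e = true then (1 : ℝ) else 0)) := by
    intro ω
    rw [Finset.prod_mul_distrib]
    congr 1
    by_cases h : ∀ e ∈ W, ω e = true
    · rw [if_pos h, Finset.prod_eq_one]
      intro e _
      rw [if_pos (h e)]
    · rw [if_neg h]
      push Not at h
      obtain ⟨e, he, he'⟩ := h
      rw [Finset.prod_eq_zero (Finset.mem_univ e)]
      rw [if_neg (fun h => he' (h he))]
  simp_rw [key]
  rw [← Fintype.prod_sum (fun e (b : Bool) =>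
    (if b = true then α else 1 - α) * (if e ∈ W → b = true then (1 : ℝ) else 0))]
  have : ∀ e, (∑ b : Bool, (if b = true then α else 1 - α) *
      (if e ∈ W → b = true then (1 : ℝ) else 0)) = if e ∈ W then α else 1 := by
    intro e
    by_cases h : e ∈ W <;> simp [h]
  simp_rw [this]
  rw [Finset.prod_ite]
  simp

theorem bprob_forall_mem {E : Type*} [Fintype E] [DecidableEq E] (α : ℝ) (W : Finset E) :
    bprob α {ω | ∀ e ∈ W, ω e = true} = α ^ W.card := by
  rw [bprob_eq_sum_prod, ← sum_bernoulliWeight_mul_forall]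
  refine Finset.sum_congr rfl fun ω _ => ?_
  simp [Set.indicator_apply]

/-- Events that prescribe `true` on pairwise disjoint sets of coordinates are independent. -/
theorem bprob_forall_not_forall {E ι : Type*} [Fintype E] [DecidableEq E] (α : ℝ)
    (S : Finset ι) (W : ι → Finset E) (hW : (S : Set ι).PairwiseDisjoint W) :
    bprob α {ω | ∀ i ∈ S, ¬ ∀ e ∈ W i, ω e = true} = ∏ i ∈ S, (1 - α ^ (W i).card) := by
  have ind : ∀ ω : E → Bool,
      Set.indicator {ω : E → Bool | ∀ i ∈ S, ¬ ∀ e ∈ W i, ω e = true} (fun _ => (1 : ℝ)) ω =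
      ∑ t ∈ S.powerset, (-1) ^ t.card *
        (if ∀ e ∈ t.biUnion W, ω e = true then (1 : ℝ) else 0) := by
    intro ω
    have h1 : Set.indicator {ω : E → Bool | ∀ i ∈ S, ¬ ∀ e ∈ W i, ω e = true}
        (fun _ => (1 : ℝ)) ω = ∏ i ∈ S, (1 + -(if ∀ e ∈ W i, ω e = true then (1 : ℝ) else 0)) := by
      by_cases h : ∀ i ∈ S, ¬ ∀ e ∈ W i, ω e = true
      · rw [Set.indicator_of_mem (by exact h), Finset.prod_eq_one]
        intro i hi
        rw [if_neg (h i hi)]; simp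
      · rw [Set.indicator_of_notMem (by exact h)]
        push Not at h
        obtain ⟨i, hi, hi'⟩ := h
        rw [Finset.prod_eq_zero hi]
        rw [if_pos hi']; simp
    rw [h1, Finset.prod_one_add]
    refine Finset.sum_congr rfl fun t _ => ?_
    rw [Finset.prod_neg, Finset.prod_boole]
    congr 2
    simp only [Finset.mem_biUnion, eq_iff_iff]
    grind
  rw [bprob_eq_sum_prod]
  simp_rw [ind, Finset.mul_sum]
  rw [Finset.sum_comm]
  have hS : ∏ i ∈ S, (1 - α ^ (W i).card) = ∏ i ∈ S, (1 + -(α ^ (W i).card)) := by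
    simp [sub_eq_add_neg]
  rw [hS, Finset.prod_one_add]
  refine Finset.sum_congr rfl fun t ht => ?_
  have hd : (t : Set ι).PairwiseDisjoint W :=
    hW.subset (by exact_mod_cast Finset.mem_powerset.1 ht)
  rw [Finset.prod_neg, Finset.prod_pow_eq_pow_sum, ← Finset.card_biUnion hd,
    ← sum_bernoulliWeight_mul_forall α (t.biUnion W), Finset.mul_sum]
  exact Finset.sum_congr rfl fun ω _ => by ring

theorem bprob_nonneg {E : Type*} [Fintype E] [DecidableEq E] {α : ℝ} (h0 : 0 ≤ α) (h1 : α ≤ 1)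
    (Ev : Set (E → Bool)) : 0 ≤ bprob α Ev := by
  rw [bprob_eq_sum_prod]
  exact Finset.sum_nonneg fun ω _ => mul_nonneg (bernoulliWeight_nonneg h0 h1 ω)
    (Set.indicator_nonneg (fun _ _ => zero_le_one) ω)

theorem bprob_mono {E : Type*} [Fintype E] [DecidableEq E] {α : ℝ} (h0 : 0 ≤ α) (h1 : α ≤ 1)
    {Ev Ev' : Set (E → Bool)} (h : Ev ⊆ Ev') : bprob α Ev ≤ bprob α Ev' := by
  rw [bprob_eq_sum_prod, bprob_eq_sum_prod]
  exact Finset.sum_le_sum fun ω _ => mul_le_mul_of_nonneg_left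
    (Set.indicator_le_indicator_of_subset h (fun _ => zero_le_one) ω)
    (bernoulliWeight_nonneg h0 h1 ω)

theorem bprob_le_add_sum {E ι : Type*} [Fintype E] [DecidableEq E] {α : ℝ} (h0 : 0 ≤ α)
    (h1 : α ≤ 1) {Ev Ev' : Set (E → Bool)} (s : Finset ι) (G : ι → Set (E → Bool))
    (h : ∀ ω ∈ Ev, ω ∈ Ev' ∨ ∃ i ∈ s, ω ∈ G i) :
    bprob α Ev ≤ bprob α Ev' + ∑ i ∈ s, bprob α (G i) := by
  simp_rw [bprob_eq_sum_prod]
  rw [Finset.sum_comm, ← Finset.sum_add_distrib]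
  refine Finset.sum_le_sum fun ω _ => ?_
  rw [← Finset.mul_sum, ← mul_add]
  refine mul_le_mul_of_nonneg_left ?_ (bernoulliWeight_nonneg h0 h1 ω)
  have nn : ∀ (T : Set (E → Bool)), 0 ≤ T.indicator (fun _ => (1 : ℝ)) ω :=
    fun T => Set.indicator_nonneg (fun _ _ => zero_le_one) ω
  by_cases hω : ω ∈ Ev
  · rw [Set.indicator_of_mem hω]
    rcases h ω hω with h | ⟨i, hi, h⟩
    · rw [Set.indicator_of_mem h]
      linarith [Finset.sum_nonneg fun i (_ : i ∈ s) => nn (G i)]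
    · have := Finset.single_le_sum (f := fun i => (G i).indicator (fun _ => (1 : ℝ)) ω)
        (fun i _ => nn (G i)) hi
      simp only [Set.indicator_of_mem h] at this
      linarith [nn Ev']
  · rw [Set.indicator_of_notMem hω]
    exact add_nonneg (nn _) (Finset.sum_nonneg fun i _ => nn _)

section PeriodicOrbits

open Function

variable {β : Type*}

/-- The forward orbit of a periodic point, as a finset. -/
noncomputable def orbitFinset (f : β → β) (x : β) : Finset β :=
  (Finset.range (minimalPeriod f x)).image (fun k => f^[k] x)

theorem card_orbitFinset (f : β → β) (x : β) : (orbitFinset f x).card = minimalPeriod f x := by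
  unfold orbitFinset
  rw [Finset.card_image_of_injOn, Finset.card_range]
  intro a ha b hb h
  exact iterate_injOn_Iio_minimalPeriod (by simpa using ha) (by simpa using hb) h

theorem iterate_mem_orbitFinset {f : β → β} {x : β} (hx : x ∈ periodicPts f) (k : ℕ) :
    f^[k] x ∈ orbitFinset f x := by
  unfold orbitFinset
  rw [Finset.mem_image]
  exact ⟨k % minimalPeriod f x, Finset.mem_range.2
    (Nat.mod_lt _ (minimalPeriod_pos_of_mem_periodicPts hx)), iterate_mod_minimalPeriod_eq⟩

theorem mem_orbitFinset_iff {f : β → β} {x y : β} (hx : x ∈ periodicPts f) :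
    y ∈ orbitFinset f x ↔ ∃ k, f^[k] x = y := by
  constructor
  · intro h
    unfold orbitFinset at h
    rw [Finset.mem_image] at h
    obtain ⟨k, _, hk⟩ := h
    exact ⟨k, hk⟩
  · rintro ⟨k, rfl⟩
    exact iterate_mem_orbitFinset hx k

theorem self_mem_orbitFinset {f : β → β} {x : β} (hx : x ∈ periodicPts f) :
    x ∈ orbitFinset f x := iterate_mem_orbitFinset hx 0

theorem iterate_mem_periodicPts {f : β → β} {x : β} (hx : x ∈ periodicPts f) (k : ℕ) :
    f^[k] x ∈ periodicPts f := by
  rw [← minimalPeriod_pos_iff_mem_periodicPts, minimalPeriod_apply_iterate hx]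
  exact minimalPeriod_pos_of_mem_periodicPts hx

theorem orbitFinset_eq_of_mem {f : β → β} {x y : β} (hx : x ∈ periodicPts f)
    (hy : y ∈ orbitFinset f x) : orbitFinset f y = orbitFinset f x := by
  obtain ⟨k, rfl⟩ := (mem_orbitFinset_iff hx).1 hy
  apply Finset.eq_of_subset_of_card_le
  · intro z hz
    obtain ⟨l, rfl⟩ := (mem_orbitFinset_iff (iterate_mem_periodicPts hx k)).1 hz
    rw [← iterate_add_apply]
    exact iterate_mem_orbitFinset hx _
  · rw [card_orbitFinset, card_orbitFinset, minimalPeriod_apply_iterate hx]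

theorem orbitFinset_pairwiseDisjoint {f : β → β} {Q : Finset β}
    (hQ : ∀ x ∈ Q, x ∈ periodicPts f) :
    ((Q.image (orbitFinset f) : Finset (Finset β)) : Set (Finset β)).PairwiseDisjoint id := by
  intro a ha b hb hab
  simp only [Finset.coe_image, Set.mem_image, Finset.mem_coe] at ha hb
  obtain ⟨x, hx, rfl⟩ := ha
  obtain ⟨y, hy, rfl⟩ := hb
  refine Finset.disjoint_left.2 fun z hz hz' => hab ?_
  rw [← orbitFinset_eq_of_mem (hQ x hx) hz, ← orbitFinset_eq_of_mem (hQ y hy) hz']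

theorem sum_image_orbitFinset {f : β → β} {Q : Finset β} (hQ : ∀ x ∈ Q, x ∈ periodicPts f)
    (hf : ∀ x ∈ Q, f x ∈ Q) (g : ℕ → ℝ) :
    ∑ γ ∈ Q.image (orbitFinset f), g γ.card =
      ∑ x ∈ Q, g (minimalPeriod f x) / minimalPeriod f x := by
  have hit : ∀ k, ∀ x ∈ Q, f^[k] x ∈ Q := by
    intro k
    induction k with
    | zero => exact fun x hx => hx
    | succ k ih =>
      intro x hx
      rw [iterate_succ_apply]
      exact ih _ (hf x hx)
  refine Finset.sum_image' _ fun x hx => ?_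
  have hfib : Q.filter (fun y => orbitFinset f y = orbitFinset f x) = orbitFinset f x := by
    ext y
    rw [Finset.mem_filter]
    constructor
    · rintro ⟨hy, h⟩
      rw [← h]
      exact self_mem_orbitFinset (hQ y hy)
    · intro h
      refine ⟨?_, orbitFinset_eq_of_mem (hQ x hx) h⟩
      obtain ⟨k, rfl⟩ := (mem_orbitFinset_iff (hQ x hx)).1 h
      exact hit k x hx
  rw [hfib, Finset.sum_congr rfl (g := fun _ => g (minimalPeriod f x) / minimalPeriod f x),
    Finset.sum_const, card_orbitFinset, nsmul_eq_mul]
  · have : (minimalPeriod f x : ℝ) ≠ 0 := by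
      exact_mod_cast (minimalPeriod_pos_of_mem_periodicPts (hQ x hx)).ne'
    field_simp
  · intro y hy
    obtain ⟨k, rfl⟩ := (mem_orbitFinset_iff (hQ x hx)).1 hy
    rw [minimalPeriod_apply_iterate (hQ x hx)]

end PeriodicOrbits

section ShiftBasics

variable {A : Type*}

theorem shiftMap_iterate_apply (k : ℕ) (x : ℤ → A) (i : ℤ) :
    shiftMap^[k] x i = x (i + k) := by
  induction k generalizing x with
  | zero => simp
  | succ k ih =>
    rw [Function.iterate_succ_apply, ih]
    simp only [shiftMap]
    congr 1
    push_cast; ring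

theorem iterate_shiftMap_eq_self_iff {p : ℕ} {x : ℤ → A} :
    shiftMap^[p] x = x ↔ ∀ i, x (i + p) = x i := by
  rw [funext_iff]
  simp only [shiftMap_iterate_apply]

theorem apply_add_mul_of_periodic {p : ℕ} {x : ℤ → A} (h : shiftMap^[p] x = x) (i k : ℤ) :
    x (i + p * k) = x i := by
  rw [iterate_shiftMap_eq_self_iff] at h
  induction k using Int.induction_on with
  | zero => simp
  | succ k ih => rw [← ih, ← h (i + p * k)]; congr 1; ring
  | pred k ih => rw [← ih, ← h (i + p * (-k - 1))]; congr 1; ring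

theorem apply_emod_of_periodic {p : ℕ} {x : ℤ → A} (h : shiftMap^[p] x = x) (i : ℤ) :
    x (i % p) = x i := by
  rw [← apply_add_mul_of_periodic h (i % p) (i / p), Int.emod_add_mul_ediv]

theorem subword_iterate_shiftMap (k : ℕ) (x : ℤ → A) (i : ℤ) (n : ℕ) :
    subword (shiftMap^[k] x) i n = subword x (i + k) n := by
  funext j
  simp only [subword, shiftMap_iterate_apply]
  congr 1; ring

theorem eq_of_subword_eq_of_periodic {p q n : ℕ} {x y : ℤ → A} (hp : 0 < p) (hq : 0 < q)
    (hx : shiftMap^[p] x = x) (hy : shiftMap^[q] y = y) (hn : p * q ≤ n)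
    (h : subword x 0 n = subword y 0 n) : x = y := by
  have hx' : shiftMap^[p * q] x = x := by
    exact Function.IsPeriodicPt.mul_const (f := shiftMap) (x := x) hx q
  have hy' : shiftMap^[p * q] y = y := by
    exact Function.IsPeriodicPt.const_mul (f := shiftMap) (x := y) hy p
  funext i
  rw [← apply_emod_of_periodic hx' i, ← apply_emod_of_periodic hy' i]
  have hpq : 0 < p * q := Nat.mul_pos hp hq
  have h0 : 0 ≤ i % ((p * q : ℕ) : ℤ) := Int.emod_nonneg _ (by positivity)
  have h1 : i % ((p * q : ℕ) : ℤ) < ((p * q : ℕ) : ℤ) := Int.emod_lt_of_pos _ (by positivity)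
  have := congrFun h ⟨(i % ((p * q : ℕ) : ℤ)).toNat, by omega⟩
  simpa only [subword, Int.toNat_of_nonneg h0, zero_add] using this

theorem finite_fixedPts_iterate_shiftMap [Finite A] {p : ℕ} (hp : 0 < p) :
    {x : ℤ → A | shiftMap^[p] x = x}.Finite := by
  refine Set.Finite.of_injOn (f := fun x => subword x 0 (p * p)) (t := Set.univ)
    (fun _ _ => Set.mem_univ _) ?_ Set.finite_univ
  intro x hx y hy h
  exact eq_of_subword_eq_of_periodic hp hp hx hy le_rfl h

theorem periodicCount_le_ncard_wordsOf [Finite A] (X : Set (ℤ → A)) {p : ℕ} (hp : 0 < p) :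
    periodicCount X p ≤ (wordsOf X p).ncard := by
  unfold periodicCount
  change Nat.card ↥{x : ℤ → A | x ∈ X ∧ shiftMap^[p] x = x} ≤ _
  rw [Nat.card_coe_set_eq]
  refine Set.ncard_le_ncard_of_injOn (fun x => subword x 0 p) ?_ ?_ (Set.toFinite _)
  · rintro x ⟨hx, -⟩
    exact ⟨x, hx, 0, fun j => rfl⟩
  · rintro x ⟨-, hx⟩ y ⟨-, hy⟩ h
    funext i
    rw [← apply_emod_of_periodic hx i, ← apply_emod_of_periodic hy i]
    have h0 : 0 ≤ i % (p : ℤ) := Int.emod_nonneg _ (by positivity)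
    have h1 : i % (p : ℤ) < (p : ℤ) := Int.emod_lt_of_pos _ (by positivity)
    have := congrFun h ⟨(i % (p : ℤ)).toNat, by omega⟩
    simpa only [subword, Int.toNat_of_nonneg h0, zero_add] using this

/-- Membership in a shift of finite type is decided by words of any large enough length. -/
theorem IsSFT.exists_length {X : Set (ℤ → A)} (h : IsSFT X) :
    ∃ m : ℕ, 0 < m ∧ ∀ n, m ≤ n → ∀ x : ℤ → A, (∀ i, subword x i n ∈ wordsOf X n) → x ∈ X := by
  obtain ⟨F, hF, rfl⟩ := h
  obtain ⟨m, hm⟩ := (hF.image Sigma.fst).bddAbove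
  refine ⟨m + 1, Nat.succ_pos m, fun n hn x hx w hw ⟨i, hi⟩ => ?_⟩
  obtain ⟨y, hy, k, hk⟩ := hx i
  have hlen : w.1 ≤ m := hm ⟨w, hw, rfl⟩
  refine hy w hw ⟨k, fun j => ?_⟩
  rw [← hi j]
  exact hk ⟨j, by omega⟩

theorem IsSFT.shiftMap_mem {X : Set (ℤ → A)} (h : IsSFT X) {x : ℤ → A} (hx : x ∈ X) :
    shiftMap x ∈ X := by
  obtain ⟨F, hF, rfl⟩ := h
  rintro w hw ⟨i, hi⟩
  refine hx w hw ⟨i + 1, fun j => ?_⟩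
  rw [← hi j]
  simp only [shiftMap]
  congr 1; ring

/-- A shift of finite type with a point whose `n`-words are allowed contains a periodic point
with the same allowed words, whose `n`-words along one period are distinct. -/
theorem exists_periodic_of_mem [Finite A] {X : Set (ℤ → A)} {n : ℕ}
    (hX : ∀ x : ℤ → A, (∀ i, subword x i n ∈ wordsOf X n) → x ∈ X) {y : ℤ → A} (hy : y ∈ X) :
    ∃ p : ℕ, 0 < p ∧ ∃ x ∈ X, shiftMap^[p] x = x ∧
      Set.InjOn (fun k : ℕ => subword x k n) (Set.Iio p) ∧
      ∀ i, ∃ j, subword x i n = subword y j n := by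
  have hex : ∃ p : ℕ, 0 < p ∧ ∃ a : ℤ, subword y a n = subword y (a + p) n := by
    obtain ⟨a, b, hab, h⟩ := Finite.exists_ne_map_eq_of_infinite (fun a : ℕ => subword y a n)
    rcases lt_or_gt_of_ne hab with hlt | hlt
    · refine ⟨b - a, by omega, a, ?_⟩
      rw [show ((a : ℤ) + ((b - a : ℕ) : ℤ)) = b by omega]
      exact h
    · refine ⟨a - b, by omega, b, ?_⟩
      rw [show ((b : ℤ) + ((a - b : ℕ) : ℤ)) = a by omega]
      exact h.symm
  obtain ⟨p, ⟨hp, a, ha⟩, hmin⟩ : ∃ p : ℕ, (0 < p ∧ ∃ a : ℤ, subword y a n = subword y (a + p) n) ∧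
      ∀ q < p, ¬ (0 < q ∧ ∃ a : ℤ, subword y a n = subword y (a + q) n) :=
    ⟨Nat.find hex, Nat.find_spec hex, fun q hq => Nat.find_min hex hq⟩
  have hper : ∀ t : ℕ, t < p + n → y (a + t) = y (a + ((t % p : ℕ) : ℤ)) := by
    intro t
    induction t using Nat.strong_induction_on with
    | _ t ih =>
      intro ht
      rcases lt_or_ge t p with h | h
      · rw [Nat.mod_eq_of_lt h]
      · have h1 := congrFun ha ⟨t - p, by omega⟩
        simp only [subword] at h1
        rw [Nat.mod_eq_sub_mod h, ← ih (t - p) (by omega) (by omega), h1]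
        congr 1; omega
  set x : ℤ → A := fun k => y (a + k % p) with hxdef
  have hsub : ∀ i : ℤ, subword x i n = subword y (a + i % p) n := by
    intro i
    funext j
    simp only [subword, hxdef]
    have h0 : 0 ≤ i % (p : ℤ) := Int.emod_nonneg _ (by positivity)
    have h1 : i % (p : ℤ) < (p : ℤ) := Int.emod_lt_of_pos _ (by positivity)
    have hj := j.2
    have := hper ((i % (p : ℤ)).toNat + j) (by omega)
    push_cast at this
    rw [Int.toNat_of_nonneg h0, Int.emod_add_emod] at this
    rw [add_assoc, this]
  have hxX : x ∈ X := hX x fun i => by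
    rw [hsub]
    exact ⟨y, hy, a + i % p, fun j => rfl⟩
  refine ⟨p, hp, x, hxX, ?_, ?_, fun i => ⟨_, hsub i⟩⟩
  · rw [iterate_shiftMap_eq_self_iff]
    intro i
    simp [hxdef]
  · have key : ∀ k l : ℕ, k < l → l < p → subword x k n ≠ subword x l n := by
      intro k l hkl hl h
      rw [hsub, hsub, Int.emod_eq_of_lt (by omega) (by omega),
        Int.emod_eq_of_lt (by omega) (by omega)] at h
      refine hmin (l - k) (by omega) ⟨by omega, a + k, ?_⟩
      rw [h]
      congr 1; omega
    intro k hk l hl h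
    rcases lt_trichotomy k l with h' | h' | h'
    · exact absurd h (key k l h' hl)
    · exact h'
    · exact absurd h.symm (key l k h' hk)

end ShiftBasics

section Emptiness

open Function

variable {A : Type*}

theorem finite_periodic_le [Finite A] (X : Set (ℤ → A)) (P : ℕ) :
    {x : ℤ → A | x ∈ X ∧ 0 < minimalPeriod shiftMap x ∧ minimalPeriod shiftMap x ≤ P}.Finite := by
  refine Set.Finite.subset ((Set.finite_Icc 1 P).biUnion
    (t := fun p => {x : ℤ → A | shiftMap^[p] x = x}) fun p hp =>
      finite_fixedPts_iterate_shiftMap hp.1) ?_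
  rintro x ⟨-, h0, h1⟩
  simp only [Set.mem_iUnion]
  exact ⟨_, ⟨h0, h1⟩, iterate_minimalPeriod⟩

/-- The periodic points of `X` of least period at most `P`. -/
noncomputable def periodicLE [Finite A] (X : Set (ℤ → A)) (P : ℕ) : Finset (ℤ → A) :=
  (finite_periodic_le X P).toFinset

theorem mem_periodicLE [Finite A] {X : Set (ℤ → A)} {P : ℕ} {x : ℤ → A} :
    x ∈ periodicLE X P ↔
      x ∈ X ∧ 0 < minimalPeriod shiftMap x ∧ minimalPeriod shiftMap x ≤ P :=
  (finite_periodic_le X P).mem_toFinset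

theorem mem_periodicPts_of_mem_periodicLE [Finite A] {X : Set (ℤ → A)} {P : ℕ} {x : ℤ → A}
    (hx : x ∈ periodicLE X P) : x ∈ periodicPts shiftMap :=
  minimalPeriod_pos_iff_mem_periodicPts.1 (mem_periodicLE.1 hx).2.1

theorem shiftMap_mem_periodicLE [Finite A] {X : Set (ℤ → A)} (hX : IsSFT X) {P : ℕ} {x : ℤ → A}
    (hx : x ∈ periodicLE X P) : shiftMap x ∈ periodicLE X P := by
  have h := mem_periodicLE.1 hx
  rw [mem_periodicLE, minimalPeriod_apply (mem_periodicPts_of_mem_periodicLE hx)]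
  exact ⟨hX.shiftMap_mem h.1, h.2⟩

/-- The finite Euler product `∏ (1 - α ^ |γ|)` over the orbits `γ` of length at most `P`. -/
noncomputable def orbitProd [Finite A] (X : Set (ℤ → A)) (P : ℕ) (α : ℝ) : ℝ :=
  ∏ γ ∈ (periodicLE X P).image (orbitFinset shiftMap), (1 - α ^ γ.card)

theorem mem_XRes_iff_of_periodic {X : Set (ℤ → A)} {n : ℕ} {ω : (Fin n → A) → Bool} {x : ℤ → A}
    (hx : x ∈ X) (hper : x ∈ periodicPts shiftMap) :
    x ∈ XRes X ω ↔
      ∀ y ∈ orbitFinset shiftMap x, ω (subword y 0 n) = true := by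
  constructor
  · rintro ⟨-, h⟩ y hy
    obtain ⟨k, rfl⟩ := (mem_orbitFinset_iff hper).1 hy
    rw [subword_iterate_shiftMap]
    exact h _
  · intro h
    refine ⟨hx, fun i => ?_⟩
    have hq := minimalPeriod_pos_of_mem_periodicPts hper
    have h0 : 0 ≤ i % (minimalPeriod shiftMap x : ℤ) := Int.emod_nonneg _ (by positivity)
    have e : subword x i n =
        subword (shiftMap^[(i % (minimalPeriod shiftMap x : ℤ)).toNat] x) 0 n := by
      rw [subword_iterate_shiftMap, Int.toNat_of_nonneg h0]
      funext j
      simp only [subword]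
      rw [← apply_add_mul_of_periodic (iterate_minimalPeriod (f := shiftMap) (x := x))
        (0 + i % (minimalPeriod shiftMap x : ℤ) + j) (i / minimalPeriod shiftMap x)]
      congr 1
      linarith [Int.emod_add_mul_ediv i (minimalPeriod shiftMap x : ℤ)]
    rw [e]
    exact h _ (iterate_mem_orbitFinset hper _)

theorem bprob_no_short_orbit [Fintype A] [DecidableEq A] (X : Set (ℤ → A)) (hX : IsSFT X)
    (α : ℝ) (P n : ℕ) (hn : P * P ≤ n) :
    bprob α {ω : (Fin n → A) → Bool | ∀ x ∈ periodicLE X P, x ∉ XRes X ω} =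
      orbitProd X P α := by
  have hinj : Set.InjOn (fun y : ℤ → A => subword y 0 n) (periodicLE X P) := by
    intro x hx y hy h
    have hx := (mem_periodicLE.1 hx).2
    have hy := (mem_periodicLE.1 hy).2
    exact eq_of_subword_eq_of_periodic hx.1 hy.1 iterate_minimalPeriod iterate_minimalPeriod
      ((Nat.mul_le_mul hx.2 hy.2).trans hn) h
  have hsub : ∀ x ∈ periodicLE X P, orbitFinset shiftMap x ⊆ periodicLE X P := by
    intro x hx y hy
    obtain ⟨k, rfl⟩ := (mem_orbitFinset_iff (mem_periodicPts_of_mem_periodicLE hx)).1 hy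
    clear hy
    induction k with
    | zero => exact hx
    | succ k ih =>
      rw [iterate_succ_apply']
      exact shiftMap_mem_periodicLE hX ih
  have hsub' : ∀ γ ∈ (periodicLE X P).image (orbitFinset shiftMap), γ ⊆ periodicLE X P := by
    intro γ hγ
    obtain ⟨x, hx, rfl⟩ := Finset.mem_image.1 hγ
    exact hsub x hx
  have hset : {ω : (Fin n → A) → Bool | ∀ x ∈ periodicLE X P, x ∉ XRes X ω} =
      {ω | ∀ γ ∈ (periodicLE X P).image (orbitFinset shiftMap),
        ¬ ∀ w ∈ γ.image (fun y => subword y 0 n), ω w = true} := by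
    ext ω
    simp only [Set.mem_ofPred_eq, Finset.forall_mem_image]
    refine forall₂_congr fun x hx => not_congr ?_
    rw [mem_XRes_iff_of_periodic (mem_periodicLE.1 hx).1 (mem_periodicPts_of_mem_periodicLE hx)]
  rw [hset, bprob_forall_not_forall, orbitProd]
  · refine Finset.prod_congr rfl fun γ hγ => ?_
    rw [Finset.card_image_of_injOn (hinj.mono (by exact_mod_cast hsub' γ hγ))]
  · intro γ hγ δ hδ hne
    have hd := orbitFinset_pairwiseDisjoint (fun x => mem_periodicPts_of_mem_periodicLE) hγ hδ hne
    simp only [Function.onFun, id] at hd ⊢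
    rw [Finset.disjoint_left] at hd ⊢
    intro w hw hw'
    obtain ⟨y, hy, rfl⟩ := Finset.mem_image.1 hw
    obtain ⟨z, hz, hzy⟩ := Finset.mem_image.1 hw'
    have := hinj (hsub' δ hδ hz) (hsub' γ hγ hy) hzy
    exact hd hy (this ▸ hz)

theorem bprob_empty_le_orbitProd [Fintype A] [DecidableEq A] (X : Set (ℤ → A)) (hX : IsSFT X)
    {α : ℝ} (h0 : 0 ≤ α) (h1 : α ≤ 1) (P n : ℕ) (hn : P * P ≤ n) :
    bprob α {ω : (Fin n → A) → Bool | XRes X ω = ∅} ≤ orbitProd X P α := by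
  rw [← bprob_no_short_orbit X hX α P n hn]
  refine bprob_mono h0 h1 fun ω hω x _ hx => ?_
  rw [Set.mem_ofPred_eq] at hω
  rw [hω] at hx
  exact hx

theorem orbitProd_le_bprob_empty_add [Fintype A] [DecidableEq A] (X : Set (ℤ → A))
    (hX : IsSFT X) {α : ℝ} (h0 : 0 ≤ α) (h1 : α ≤ 1) (P n : ℕ) (hn : P * P ≤ n)
    (hloc : ∀ x : ℤ → A, (∀ i, subword x i n ∈ wordsOf X n) → x ∈ X) :
    orbitProd X P α ≤ bprob α {ω : (Fin n → A) → Bool | XRes X ω = ∅} +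
      ∑ p ∈ Finset.Ioc P (Fintype.card (Fin n → A)), (periodicCount X p : ℝ) * α ^ p := by
  rw [← bprob_no_short_orbit X hX α P n hn]
  have hfin : ∀ p : ℕ, 0 < p → {x : ℤ → A | x ∈ X ∧ shiftMap^[p] x = x}.Finite := fun p hp =>
    (finite_fixedPts_iterate_shiftMap hp).subset fun x hx => hx.2
  let T : ℕ → Finset (ℤ → A) := fun p =>
    if hp : 0 < p then (hfin p hp).toFinset.filter fun x =>
      Set.InjOn (fun k : ℕ => subword x k n) (Set.Iio p) else ∅
  have hT : ∀ p, 0 < p → ∀ x, x ∈ T p ↔ (x ∈ X ∧ shiftMap^[p] x = x) ∧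
      Set.InjOn (fun k : ℕ => subword x k n) (Set.Iio p) := by
    intro p hp x
    simp [T, hp]
  have hTcard : ∀ p, 0 < p → ((T p).card : ℝ) ≤ periodicCount X p := by
    intro p hp
    have : periodicCount X p = (hfin p hp).toFinset.card := by
      unfold periodicCount
      rw [← Set.ncard_eq_toFinset_card _ (hfin p hp), ← Nat.card_coe_set_eq]
      rfl
    rw [this]
    simp only [T, hp, dif_pos]
    exact_mod_cast Finset.card_filter_le _ _
  refine (bprob_le_add_sum h0 h1
    (Ev' := {ω : (Fin n → A) → Bool | XRes X ω = ∅})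
    ((Finset.Ioc P (Fintype.card (Fin n → A))).sigma T)
    (fun i => {ω | ∀ w ∈ (Finset.range i.1).image (fun k : ℕ => subword i.2 k n), ω w = true})
    ?_).trans ?_
  · intro ω hω
    rw [or_iff_not_imp_left]
    intro hne
    obtain ⟨y, hy⟩ := Set.nonempty_iff_ne_empty.2 hne
    obtain ⟨p, hp, x, hx, hxp, hinj, hxy⟩ := exists_periodic_of_mem hloc hy.1
    have hxω : ∀ i, ω (subword x i n) = true := by
      intro i
      obtain ⟨j, hj⟩ := hxy i
      rw [hj]
      exact hy.2 j
    refine ⟨⟨p, x⟩, ?_, ?_⟩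
    · rw [Finset.mem_sigma, Finset.mem_Ioc]
      refine ⟨⟨?_, ?_⟩, (hT p hp x).2 ⟨⟨hx, hxp⟩, hinj⟩⟩
      · by_contra hP
        have hP : p ≤ P := not_lt.1 hP
        have hle : minimalPeriod shiftMap x ≤ p := IsPeriodicPt.minimalPeriod_le hp hxp
        exact hω x (mem_periodicLE.2 ⟨hx, IsPeriodicPt.minimalPeriod_pos hp hxp, hle.trans hP⟩)
          ⟨hx, hxω⟩
      · have := Finset.card_le_univ ((Finset.range p).image (fun k : ℕ => subword x k n))
        rwa [Finset.card_image_of_injOn (by simpa using hinj), Finset.card_range] at this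
    · intro w hw
      obtain ⟨k, -, rfl⟩ := Finset.mem_image.1 hw
      exact hxω k
  · rw [add_le_add_iff_left, Finset.sum_sigma]
    refine Finset.sum_le_sum fun p hp => ?_
    have hp : 0 < p := by
      have := (Finset.mem_Ioc.1 hp).1
      omega
    refine le_trans (le_of_eq ?_)
      (mul_le_mul_of_nonneg_right (hTcard p hp) (pow_nonneg h0 p))
    rw [← nsmul_eq_mul, ← Finset.sum_const]
    refine Finset.sum_congr rfl fun x hx => ?_
    rw [bprob_forall_mem, Finset.card_image_of_injOn (by simpa using ((hT p hp x).1 hx).2),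
      Finset.card_range]

theorem hasSum_ite_dvd {t : ℝ} (h0 : 0 ≤ t) (h1 : t < 1) {q : ℕ} (hq : 0 < q) :
    HasSum (fun p : ℕ => if q ∣ p + 1 then t ^ (p + 1) / ((p : ℝ) + 1) else 0)
      (-Real.log (1 - t ^ q) / q) := by
  have hinj : Function.Injective (fun k : ℕ => q * (k + 1) - 1) := by
    intro a b h
    have ha : 0 < q * (a + 1) := by positivity
    have hb : 0 < q * (b + 1) := by positivity
    have : q * (a + 1) = q * (b + 1) := by simp only at h; omega
    simpa using Nat.eq_of_mul_eq_mul_left hq this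
  rw [← hinj.hasSum_iff]
  · have hlt : |t ^ q| < 1 := by
      rw [abs_of_nonneg (by positivity)]
      exact pow_lt_one₀ h0 h1 hq.ne'
    refine ((Real.hasSum_pow_div_log_of_abs_lt_one hlt).div_const (q : ℝ)).congr_fun ?_
    intro k
    have ha : 0 < q * (k + 1) := by positivity
    have e : q * (k + 1) - 1 + 1 = q * (k + 1) := by omega
    have e' : (((q * (k + 1) - 1 : ℕ) : ℝ) + 1) = q * (k + 1) := by exact_mod_cast e
    simp only [Function.comp, e, e', dvd_mul_right, if_true, pow_mul]
    field_simp
  · intro p hp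
    rw [if_neg]
    rintro ⟨k, hk⟩
    refine hp ⟨k - 1, ?_⟩
    have : k ≠ 0 := by rintro rfl; simp at hk
    simp only
    rw [Nat.sub_add_cancel (by omega), ← hk]
    simp

theorem card_filter_periodicLE [Finite A] (X : Set (ℤ → A)) (P p : ℕ) (hp : 0 < p) :
    ((periodicLE X P).filter fun x => minimalPeriod shiftMap x ∣ p).card ≤ periodicCount X p ∧
    (p ≤ P →
      ((periodicLE X P).filter fun x => minimalPeriod shiftMap x ∣ p).card =
        periodicCount X p) := by
  have hfin : {x : ℤ → A | x ∈ X ∧ shiftMap^[p] x = x}.Finite :=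
    (finite_fixedPts_iterate_shiftMap hp).subset fun x hx => hx.2
  have hc : periodicCount X p = hfin.toFinset.card := by
    unfold periodicCount
    rw [← Set.ncard_eq_toFinset_card _ hfin, ← Nat.card_coe_set_eq]
    rfl
  have hss : ((periodicLE X P).filter fun x => minimalPeriod shiftMap x ∣ p) ⊆
      hfin.toFinset := by
    intro x hx
    rw [Finset.mem_filter, mem_periodicLE] at hx
    rw [Set.Finite.mem_toFinset]
    exact ⟨hx.1.1, isPeriodicPt_iff_minimalPeriod_dvd.2 hx.2⟩
  rw [hc]
  refine ⟨Finset.card_le_card hss, fun hpP => congrArg _ (hss.antisymm fun x hx => ?_)⟩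
  rw [Set.Finite.mem_toFinset] at hx
  have hper : IsPeriodicPt shiftMap p x := hx.2
  rw [Finset.mem_filter, mem_periodicLE]
  exact ⟨⟨hx.1, hper.minimalPeriod_pos hp, (hper.minimalPeriod_le hp).trans hpP⟩,
    hper.minimalPeriod_dvd⟩

/-- The finite Euler product is controlled by the partial sums of the series defining
the zeta function. -/
theorem exists_orbitProd_eq_exp [Finite A] {X : Set (ℤ → A)} (hX : IsSFT X) {t : ℝ}
    (h0 : 0 ≤ t) (h1 : t < 1) (P : ℕ) :
    ∃ S : ℝ, orbitProd X P t = Real.exp (-S) ∧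
      ∑ p ∈ Finset.range P, (periodicCount X (p + 1) : ℝ) / (p + 1) * t ^ (p + 1) ≤ S ∧
      (Summable (fun p : ℕ => (periodicCount X (p + 1) : ℝ) / (p + 1) * t ^ (p + 1)) →
        S ≤ ∑' p : ℕ, (periodicCount X (p + 1) : ℝ) / (p + 1) * t ^ (p + 1)) := by
  set S : ℝ := ∑ x ∈ periodicLE X P,
    -Real.log (1 - t ^ minimalPeriod shiftMap x) / minimalPeriod shiftMap x with hS
  have hsum : HasSum (fun p : ℕ => ∑ x ∈ periodicLE X P,
      if minimalPeriod shiftMap x ∣ p + 1 then t ^ (p + 1) / ((p : ℝ) + 1) else 0) S :=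
    hasSum_sum fun x hx => hasSum_ite_dvd h0 h1 (mem_periodicLE.1 hx).2.1
  have hterm : ∀ p : ℕ, (∑ x ∈ periodicLE X P,
      if minimalPeriod shiftMap x ∣ p + 1 then t ^ (p + 1) / ((p : ℝ) + 1) else 0) =
      (((periodicLE X P).filter fun x => minimalPeriod shiftMap x ∣ p + 1).card : ℝ) /
        (p + 1) * t ^ (p + 1) := by
    intro p
    rw [← Finset.sum_filter, Finset.sum_const, nsmul_eq_mul]
    ring
  simp_rw [hterm] at hsum
  have hle : ∀ p : ℕ,
      (((periodicLE X P).filter fun x => minimalPeriod shiftMap x ∣ p + 1).card : ℝ) /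
        (p + 1) * t ^ (p + 1) ≤ (periodicCount X (p + 1) : ℝ) / (p + 1) * t ^ (p + 1) := by
    intro p
    have := (card_filter_periodicLE X P (p + 1) p.succ_pos).1
    gcongr
  refine ⟨S, ?_, ?_, fun hs => ?_⟩
  · have hpos : ∀ γ ∈ (periodicLE X P).image (orbitFinset shiftMap), 0 < 1 - t ^ γ.card := by
      intro γ hγ
      obtain ⟨x, hx, rfl⟩ := Finset.mem_image.1 hγ
      rw [card_orbitFinset]
      linarith [pow_lt_one₀ h0 h1 (mem_periodicLE.1 hx).2.1.ne']
    have hS' := sum_image_orbitFinset (fun x => mem_periodicPts_of_mem_periodicLE)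
      (fun x => shiftMap_mem_periodicLE hX (P := P)) (fun k => -Real.log (1 - t ^ k))
    rw [hS, ← hS', Finset.sum_neg_distrib, neg_neg, Real.exp_sum, orbitProd]
    exact Finset.prod_congr rfl fun γ hγ => (Real.exp_log (hpos γ hγ)).symm
  · refine le_trans (le_of_eq ?_) (sum_le_hasSum (Finset.range P) (fun p _ => by positivity) hsum)
    refine Finset.sum_congr rfl fun p hp => ?_
    rw [(card_filter_periodicLE X P (p + 1) p.succ_pos).2 (Finset.mem_range.1 hp)]
  · exact hasSum_le hle hsum hs.hasSum

theorem tendsto_orbitProd [Finite A] {X : Set (ℤ → A)} (hX : IsSFT X) {t : ℝ}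
    (h0 : 0 ≤ t) (h1 : t < 1)
    (hs : Summable (fun p : ℕ => (periodicCount X (p + 1) : ℝ) / (p + 1) * t ^ (p + 1))) :
    Tendsto (fun P => orbitProd X P t) atTop (𝓝 (zetaX X t)⁻¹) := by
  choose S hS1 hS2 hS3 using exists_orbitProd_eq_exp hX h0 h1
  simp_rw [hS1, zetaX, ← Real.exp_neg]
  refine (Real.continuous_exp.tendsto _).comp (Tendsto.neg ?_)
  exact tendsto_of_tendsto_of_tendsto_of_le_of_le hs.hasSum.tendsto_sum_nat tendsto_const_nhds
    hS2 fun P => hS3 P hs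

theorem tendsto_orbitProd_zero [Finite A] {X : Set (ℤ → A)} (hX : IsSFT X) {t : ℝ}
    (h0 : 0 ≤ t) (h1 : t < 1)
    (hs : ¬ Summable (fun p : ℕ => (periodicCount X (p + 1) : ℝ) / (p + 1) * t ^ (p + 1))) :
    Tendsto (fun P => orbitProd X P t) atTop (𝓝 0) := by
  choose S hS1 hS2 hS3 using exists_orbitProd_eq_exp hX h0 h1
  simp_rw [hS1]
  refine Real.tendsto_exp_neg_atTop_nhds_zero.comp ?_
  refine tendsto_atTop_mono hS2 ?_
  exact (not_summable_iff_tendsto_nat_atTop_of_nonneg fun p => by positivity).1 hs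

end Emptiness

section PowerSums

theorem trace_pow_eq_sum {V : Type*} [AddCommGroup V] [Module ℂ V] [FiniteDimensional ℂ V]
    (f : Module.End ℂ V) :
    ∃ (s : Finset ℂ) (d : ℂ → ℕ), (∀ μ ∈ s, 0 < d μ) ∧ (∀ μ, f.HasEigenvalue μ → μ ∈ s) ∧
      ∀ p : ℕ, LinearMap.trace ℂ V (f ^ p) = ∑ μ ∈ s, (d μ : ℂ) * μ ^ p := by
  have hinternal : DirectSum.IsInternal f.maxGenEigenspace :=
    (DirectSum.isInternal_submodule_iff_iSupIndep_and_iSup_eq_top _).2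
      ⟨f.independent_maxGenEigenspace, Module.End.iSup_maxGenEigenspace_eq_top f⟩
  have hfin : {μ | f.maxGenEigenspace μ ≠ ⊥}.Finite :=
    WellFoundedGT.finite_ne_bot_of_iSupIndep f.independent_maxGenEigenspace
  refine ⟨hfin.toFinset, fun μ => Module.finrank ℂ (f.maxGenEigenspace μ), ?_, ?_, fun p => ?_⟩
  · intro μ hμ
    have hμ : f.maxGenEigenspace μ ≠ ⊥ := hfin.mem_toFinset.1 hμ
    exact Module.finrank_pos_iff.2 (Submodule.nontrivial_iff_ne_bot.2 hμ)
  · intro μ hμ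
    rw [Set.Finite.mem_toFinset]
    obtain ⟨v, hv⟩ := hμ.exists_hasEigenvector
    intro hbot
    have : v ∈ f.maxGenEigenspace μ := by
      rw [Module.End.mem_maxGenEigenspace]
      exact ⟨1, by simp [hv.apply_eq_smul]⟩
    rw [hbot, Submodule.mem_bot] at this
    exact hv.2 this
  · have hmaps := fun μ => f.mapsTo_maxGenEigenspace_of_comm (Commute.pow_right (Commute.refl f) p) μ
    rw [LinearMap.trace_eq_sum_trace_restrict' hinternal hfin hmaps]
    refine Finset.sum_congr rfl fun μ _ => ?_
    set g := f.restrict (f.mapsTo_maxGenEigenspace_of_comm (Commute.refl f) μ) with hg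
    have hgp : (f ^ p).restrict (hmaps μ) = g ^ p := by
      exact (Module.End.pow_restrict p _).symm
    rw [hgp]
    have hnil : IsNilpotent (g - algebraMap ℂ _ μ) :=
      f.isNilpotent_restrict_maxGenEigenspace_sub_algebraMap μ
    have hcomm : Commute g (algebraMap ℂ (Module.End ℂ (f.maxGenEigenspace μ)) μ) :=
      (Algebra.commutes μ g).symm
    have hnil' : IsNilpotent (g ^ p - (algebraMap ℂ (Module.End ℂ (f.maxGenEigenspace μ)) μ) ^ p) := by
      rw [← hcomm.mul_geom_sum₂ p]
      refine Commute.isNilpotent_mul_right ?_ hnil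
      refine Commute.sum_right _ _ _ fun i _ => ?_
      refine Commute.mul_right (Commute.pow_right ?_ _) (Commute.pow_right ?_ _)
      · exact (Commute.refl g).sub_left hcomm.symm
      · exact hcomm.sub_left (Commute.refl _)
    have h0 := (LinearMap.isNilpotent_trace_of_isNilpotent hnil').eq_zero
    rw [map_sub, sub_eq_zero] at h0
    rw [h0, ← map_pow, Algebra.algebraMap_eq_smul_one, map_smul, LinearMap.trace_one, smul_eq_mul,
      mul_comm]

theorem norm_sum_Ico_pow_le {w : ℂ} (hw : ‖w‖ ≤ 1) (hw1 : w ≠ 1) (m n : ℕ) (hmn : m ≤ n) :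
    ‖∑ p ∈ Finset.Ico m n, w ^ (p + 1)‖ ≤ 2 / ‖w - 1‖ := by
  have h : ∑ p ∈ Finset.Ico m n, w ^ (p + 1) = w * ((w ^ n - w ^ m) / (w - 1)) := by
    rw [← geom_sum_Ico hw1 hmn, Finset.mul_sum]
    exact Finset.sum_congr rfl fun p _ => by ring
  rw [h, norm_mul, norm_div]
  have h2 : ‖w ^ n - w ^ m‖ ≤ 2 := by
    refine (norm_sub_le _ _).trans ?_
    rw [norm_pow, norm_pow]
    linarith [pow_le_one₀ (norm_nonneg w) hw (n := n), pow_le_one₀ (norm_nonneg w) hw (n := m)]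
  calc ‖w‖ * (‖w ^ n - w ^ m‖ / ‖w - 1‖) ≤ 1 * (2 / ‖w - 1‖) := by gcongr
    _ = _ := one_mul _

/-- If nonnegative reals `a p` are the power sums of complex numbers with multiplicities, then
the series `∑ a p / p * t ^ p` diverges from the reciprocal of the largest modulus on. -/
theorem not_summable_of_eq_power_sum {s : Finset ℂ} {d : ℂ → ℕ} (hd : ∀ μ ∈ s, 0 < d μ)
    {a : ℕ → ℝ} (ha0 : ∀ p, 0 ≤ a p) (ha : ∀ p, (a p : ℂ) = ∑ μ ∈ s, (d μ : ℂ) * μ ^ p)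
    {ν : ℂ} (hν : ν ∈ s) (hν0 : ν ≠ 0) (hmax : ∀ μ ∈ s, ‖μ‖ ≤ ‖ν‖) {t : ℝ} (ht : 1 / ‖ν‖ ≤ t) :
    ¬ Summable (fun p : ℕ => a (p + 1) / (p + 1) * t ^ (p + 1)) := by
  intro hs
  have hr : 0 < ‖ν‖ := norm_pos_iff.2 hν0
  have hs' : Summable (fun p : ℕ => a (p + 1) / (p + 1) * (1 / ‖ν‖) ^ (p + 1)) := by
    refine Summable.of_nonneg_of_le (fun p => ?_) (fun p => ?_) hs
    · have := ha0 (p + 1); positivity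
    · have := ha0 (p + 1); gcongr
  set c : ℕ → ℝ := fun p => a (p + 1) / (p + 1) * (1 / ‖ν‖) ^ (p + 1) with hc
  have hc0 : ∀ p, 0 ≤ c p := fun p => by
    have := ha0 (p + 1)
    simp only [hc]; positivity
  set C : ℝ := ∑ μ ∈ s.erase ν, (d μ : ℝ) * (2 / ‖μ / ν - 1‖) with hC
  have hlow : ∀ P : ℕ, (P : ℝ) - C ≤ 2 * P * ∑ p ∈ Finset.Ico P (2 * P), c p := by
    intro P
    have hP : P ≤ 2 * P := by omega
    have e1 : ∑ p ∈ Finset.Ico P (2 * P), ((a (p + 1) : ℂ) / ν ^ (p + 1)) =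
        (d ν : ℂ) * P + ∑ μ ∈ s.erase ν, (d μ : ℂ) *
          ∑ p ∈ Finset.Ico P (2 * P), (μ / ν) ^ (p + 1) := by
      have : ∀ p : ℕ, ((a (p + 1) : ℂ) / ν ^ (p + 1)) =
          ∑ μ ∈ s, (d μ : ℂ) * (μ / ν) ^ (p + 1) := by
        intro p
        rw [ha, Finset.sum_div]
        exact Finset.sum_congr rfl fun μ _ => by rw [div_pow]; ring
      simp_rw [this]
      rw [Finset.sum_comm, ← Finset.add_sum_erase _ _ hν, div_self hν0]
      congr 1
      · simp only [one_pow, mul_one, Finset.sum_const, Nat.card_Ico, nsmul_eq_mul]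
        rw [show 2 * P - P = P by omega]; ring
      · exact Finset.sum_congr rfl fun μ _ => by rw [Finset.mul_sum]
    have e2 : ‖∑ μ ∈ s.erase ν, (d μ : ℂ) *
        ∑ p ∈ Finset.Ico P (2 * P), (μ / ν) ^ (p + 1)‖ ≤ C := by
      refine (norm_sum_le _ _).trans (Finset.sum_le_sum fun μ hμ => ?_)
      rw [norm_mul, Complex.norm_natCast]
      refine mul_le_mul_of_nonneg_left (norm_sum_Ico_pow_le ?_ ?_ _ _ hP) (Nat.cast_nonneg _)
      · rw [norm_div, div_le_one hr]
        exact hmax μ (Finset.mem_of_mem_erase hμ)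
      · rw [Ne, div_eq_one_iff_eq hν0]
        exact Finset.ne_of_mem_erase hμ
    have e3 : ‖∑ p ∈ Finset.Ico P (2 * P), ((a (p + 1) : ℂ) / ν ^ (p + 1))‖ ≤
        2 * P * ∑ p ∈ Finset.Ico P (2 * P), c p := by
      rw [Finset.mul_sum]
      refine (norm_sum_le _ _).trans (Finset.sum_le_sum fun p hp => ?_)
      rw [norm_div, norm_pow, Complex.norm_real, Real.norm_of_nonneg (ha0 _)]
      have hp1 : (p : ℝ) + 1 ≤ 2 * P := by
        have := (Finset.mem_Ico.1 hp).2
        exact_mod_cast this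
      have : a (p + 1) / ‖ν‖ ^ (p + 1) = ((p : ℝ) + 1) * c p := by
        simp only [hc, one_div, inv_pow]
        field_simp
      rw [this]
      exact mul_le_mul_of_nonneg_right hp1 (hc0 p)
    have hdν : (P : ℝ) ≤ ‖(d ν : ℂ) * P‖ := by
      rw [norm_mul, Complex.norm_natCast, Complex.norm_natCast]
      have : (1 : ℝ) ≤ d ν := by exact_mod_cast hd ν hν
      nlinarith [(Nat.cast_nonneg P : (0 : ℝ) ≤ P)]
    have e4 := norm_sub_le_norm_add ((d ν : ℂ) * P) (∑ μ ∈ s.erase ν, (d μ : ℂ) *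
        ∑ p ∈ Finset.Ico P (2 * P), (μ / ν) ^ (p + 1))
    rw [← e1] at e4
    linarith
  have hlim : Tendsto (fun P : ℕ => ∑ p ∈ Finset.Ico P (2 * P), c p) atTop (𝓝 0) := by
    have h1 := hs'.hasSum.tendsto_sum_nat
    have h2 := h1.comp (tendsto_id.const_mul_atTop' (r := 2) (by norm_num))
    have := h2.sub h1
    rw [sub_self] at this
    refine this.congr fun P => ?_
    rw [Finset.sum_Ico_eq_sub _ (by omega : P ≤ 2 * P)]
    rfl
  have hev := hlim.eventually (gt_mem_nhds (by norm_num : (0 : ℝ) < 1 / 4))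
  obtain ⟨P, hP1, hP2⟩ := (hev.and (eventually_gt_atTop ⌈2 * C⌉₊)).exists
  have := hlow P
  have hP3 : 2 * C < P := (Nat.le_ceil _).trans_lt (by exact_mod_cast hP2)
  have hPn : (0 : ℝ) ≤ P := Nat.cast_nonneg P
  have : 2 * (P : ℝ) * ∑ p ∈ Finset.Ico P (2 * P), c p ≤ 2 * P * (1 / 4) := by gcongr
  linarith

end PowerSums

section SpectralRadius

attribute [local instance] Matrix.linftyOpNormedRing Matrix.linftyOpNormedAlgebra

theorem norm_sum_entries_le {V : Type*} [Fintype V] [DecidableEq V] (M : Matrix V V ℂ) :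
    ‖∑ u, ∑ v, M u v‖ ≤ Fintype.card V * ‖M‖ := by
  refine (norm_sum_le _ _).trans ?_
  rw [← nsmul_eq_mul, ← Finset.card_univ, ← Finset.sum_const]
  refine Finset.sum_le_sum fun u _ => (norm_sum_le _ _).trans ?_
  rw [Matrix.linfty_opNorm_def]
  have := Finset.le_sup (f := fun i => ∑ j, ‖M i j‖₊) (Finset.mem_univ u)
  have h : ((∑ j, ‖M u j‖₊ : NNReal) : ℝ) ≤
      ((Finset.univ.sup fun i => ∑ j, ‖M i j‖₊ : NNReal) : ℝ) := NNReal.coe_le_coe.2 this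
  simpa only [NNReal.coe_sum, coe_nnnorm] using h

/-- A matrix whose powers have total mass growing at rate at least `L` has an eigenvalue of
modulus at least `L`. -/
theorem exists_eigenvalue_of_growth {V : Type*} [Fintype V] [DecidableEq V] [Nonempty V]
    (M : Matrix V V ℂ) {L : ℝ} {W : ℕ → ℝ} (hW0 : ∀ n, 0 < W n)
    (hW : ∀ n, W n ≤ ‖∑ u, ∑ v, (M ^ n) u v‖)
    (hlim : Tendsto (fun n : ℕ => Real.log (W n) / n) atTop (𝓝 (Real.log L))) :
    ∃ μ : ℂ, Module.End.HasEigenvalue (Matrix.toLin' M) μ ∧ L ≤ ‖μ‖ := by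
  obtain ⟨k, hk, hkr⟩ := spectrum.exists_nnnorm_eq_spectralRadius M
  refine ⟨k, ?_, ?_⟩
  · rw [Module.End.hasEigenvalue_iff_mem_spectrum, Matrix.spectrum_toLin']
    exact hk
  by_contra! hlt
  obtain ⟨r, hkr', hrL⟩ := exists_between hlt
  have hr0 : 0 < r := (norm_nonneg k).trans_lt hkr'
  have hG := spectrum.pow_norm_pow_one_div_tendsto_nhds_spectralRadius M
  rw [← hkr] at hG
  have hlt' : (‖k‖₊ : ENNReal) < ENNReal.ofReal r := by
    rw [← enorm_eq_nnnorm, ← ofReal_norm]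
    exact (ENNReal.ofReal_lt_ofReal_iff hr0).2 hkr'
  have hev : ∀ᶠ n : ℕ in atTop, Real.log (W n) / n ≤
      Real.log (Fintype.card V) / n + Real.log r := by
    filter_upwards [hG.eventually (gt_mem_nhds hlt'), eventually_gt_atTop 0] with n hn hn0
    have hn0' : (0 : ℝ) < n := by exact_mod_cast hn0
    have h1 : ‖M ^ n‖ ^ (1 / n : ℝ) < r := (ENNReal.ofReal_lt_ofReal_iff hr0).1 hn
    have h2 : ‖M ^ n‖ ≤ r ^ n := by
      have := pow_le_pow_left₀ (by positivity) h1.le n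
      rwa [← Real.rpow_natCast, ← Real.rpow_mul (norm_nonneg _), one_div,
        inv_mul_cancel₀ hn0'.ne', Real.rpow_one] at this
    have hcard : (0 : ℝ) < Fintype.card V := by exact_mod_cast Fintype.card_pos
    have h3 : W n ≤ Fintype.card V * r ^ n :=
      (hW n).trans ((norm_sum_entries_le _).trans (by gcongr))
    have h4 := Real.log_le_log (hW0 n) h3
    rw [Real.log_mul hcard.ne' (by positivity), Real.log_pow] at h4
    rw [div_add' _ _ _ hn0'.ne', div_le_div_iff_of_pos_right hn0']
    linarith
  have hlim2 : Tendsto (fun n : ℕ => Real.log (Fintype.card V) / n + Real.log r) atTop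
      (𝓝 (0 + Real.log r)) := (tendsto_const_div_atTop_nhds_zero_nat _).add_const _
  have := le_of_tendsto_of_tendsto hlim hlim2 hev
  rw [zero_add] at this
  linarith [Real.log_lt_log hr0 hrL]

end SpectralRadius

section Walks

theorem Matrix.pow_apply_eq_sum_walks {V R : Type*} [Fintype V] [DecidableEq V] [CommSemiring R]
    (M : Matrix V V R) (n : ℕ) (u v : V) :
    (M ^ n) u v = ∑ w : Fin (n + 1) → V,
      if w 0 = u ∧ w (Fin.last n) = v then ∏ i : Fin n, M (w i.castSucc) (w i.succ) else 0 := by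
  induction n generalizing u with
  | zero =>
    rw [← (Equiv.funUnique (Fin 1) V).symm.sum_comp]
    rw [Finset.sum_eq_single u]
    · simp [Matrix.one_apply]
    · intro b _ hb; simp [hb]
    · simp
  | succ n ih =>
    rw [pow_succ', Matrix.mul_apply, ← (Fin.consEquiv fun _ => V).sum_comp, Fintype.sum_prod_type]
    symm
    rw [Finset.sum_eq_single u]
    · simp_rw [ih, Finset.mul_sum]
      rw [Finset.sum_comm]
      refine Finset.sum_congr rfl fun w _ => ?_
      symm
      rw [Finset.sum_eq_single (w 0)]
      · simp [Fin.consEquiv, Fin.prod_univ_succ, ← Fin.succ_last]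
      · intro b _ hb; simp [hb.symm]
      · simp
    · intro b _ hb
      simp [Fin.consEquiv, hb]
    · simp

/-- The `0`-`1` matrix of a relation. -/
noncomputable def relMatrix {V : Type*} (r : V → V → Prop) : Matrix V V ℂ :=
  fun u v => if r u v then 1 else 0

theorem relMatrix_pow_apply {V : Type*} [Fintype V] [DecidableEq V] (r : V → V → Prop)
    (n : ℕ) (u v : V) :
    (relMatrix r ^ n) u v = (Finset.univ.filter fun w : Fin (n + 1) → V =>
      (w 0 = u ∧ w (Fin.last n) = v) ∧ ∀ i : Fin n, r (w i.castSucc) (w i.succ)).card := by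
  rw [Matrix.pow_apply_eq_sum_walks, Finset.card_filter, Nat.cast_sum]
  refine Finset.sum_congr rfl fun w _ => ?_
  by_cases h : w 0 = u ∧ w (Fin.last n) = v
  · simp only [h, relMatrix, Finset.prod_ite_zero]
    simp
  · simp [h]

theorem trace_relMatrix_pow {V : Type*} [Fintype V] [DecidableEq V] (r : V → V → Prop) (n : ℕ) :
    (relMatrix r ^ n).trace = (Finset.univ.filter fun w : Fin (n + 1) → V =>
      w (Fin.last n) = w 0 ∧ ∀ i : Fin n, r (w i.castSucc) (w i.succ)).card := by
  simp_rw [Matrix.trace, Matrix.diag, relMatrix_pow_apply, Finset.card_filter]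
  push_cast
  rw [Finset.sum_comm]
  refine Finset.sum_congr rfl fun w _ => ?_
  rw [Finset.sum_eq_single (w 0)]
  · simp
  · intro b _ hb; simp [hb.symm]
  · simp

theorem sum_relMatrix_pow {V : Type*} [Fintype V] [DecidableEq V] (r : V → V → Prop) (n : ℕ) :
    ∑ u, ∑ v, (relMatrix r ^ n) u v = (Finset.univ.filter fun w : Fin (n + 1) → V =>
      ∀ i : Fin n, r (w i.castSucc) (w i.succ)).card := by
  simp_rw [relMatrix_pow_apply, Finset.card_filter]
  push_cast
  simp_rw [Finset.sum_comm (s := Finset.univ (α := V)) (t := Finset.univ (α := Fin (n + 1) → V))]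
  refine Finset.sum_congr rfl fun w _ => ?_
  rw [Finset.sum_eq_single (w 0), Finset.sum_eq_single (w (Fin.last n))]
  · simp
  · intro b _ hb; simp [hb.symm]
  · simp
  · intro b _ hb; simp [hb.symm]
  · simp

end Walks

section WordGraph

variable {A : Type*}

/-- The edges of the graph of `m`-words of `X`: consecutive words overlap in `m - 1` letters. -/
def WordStep (X : Set (ℤ → A)) (m : ℕ) (u v : Fin m → A) : Prop :=
  u ∈ wordsOf X m ∧ ∀ (j : ℕ) (hj : j + 1 < m), u ⟨j + 1, hj⟩ = v ⟨j, by omega⟩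

theorem ncard_wordsOf_le_card_walks [Fintype A] (X : Set (ℤ → A)) {m : ℕ} (hm : 0 < m) (n : ℕ) :
    (wordsOf X (n + m)).ncard ≤ (Finset.univ.filter fun w : Fin (n + 1) → (Fin m → A) =>
      ∀ i : Fin n, WordStep X m (w i.castSucc) (w i.succ)).card := by
  rw [← Set.ncard_coe_finset]
  refine Set.ncard_le_ncard_of_injOn (fun u i j => u ⟨i + j, by omega⟩) ?_ ?_ (Set.toFinite _)
  · rintro u ⟨x, hx, k, hk⟩
    simp only [Finset.coe_filter, Finset.mem_univ, true_and, Set.mem_ofPred_eq]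
    refine fun i => ⟨⟨x, hx, k + i, fun j => ?_⟩, fun j hj => ?_⟩
    · refine Eq.trans ?_ (hk ⟨i + j, by omega⟩)
      congr 1
      push_cast
      ring
    · refine congrArg u (Fin.ext ?_)
      simp only [Fin.val_castSucc, Fin.val_succ]
      ring
  · intro u _ v _ huv
    funext ⟨k, hk⟩
    rcases Nat.lt_or_ge k n with h | h
    · have := congrFun (congrFun huv ⟨k, by omega⟩) ⟨0, hm⟩
      simpa using this
    · have := congrFun (congrFun huv ⟨n, by omega⟩) ⟨k - n, by omega⟩
      simpa [Nat.add_sub_cancel' h] using this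

theorem card_closed_walks_le_periodicCount [Fintype A] {X : Set (ℤ → A)} {m : ℕ} (hm : 0 < m)
    (hloc : ∀ x : ℤ → A, (∀ i, subword x i m ∈ wordsOf X m) → x ∈ X) {p : ℕ} (hp : 0 < p) :
    (Finset.univ.filter fun w : Fin (p + 1) → (Fin m → A) =>
      w (Fin.last p) = w 0 ∧ ∀ i : Fin p, WordStep X m (w i.castSucc) (w i.succ)).card ≤
      periodicCount X p := by
  have hfin : {x : ℤ → A | x ∈ X ∧ shiftMap^[p] x = x}.Finite :=
    (finite_fixedPts_iterate_shiftMap hp).subset fun x hx => hx.2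
  have hpz : (0 : ℤ) < p := by exact_mod_cast hp
  have hlt : ∀ k : ℤ, (k % p).toNat < p := fun k => by
    have := Int.emod_lt_of_pos k hpz
    have := Int.emod_nonneg k hpz.ne'
    omega
  have key : ∀ w : Fin (p + 1) → (Fin m → A), w (Fin.last p) = w 0 →
      (∀ i : Fin p, WordStep X m (w i.castSucc) (w i.succ)) →
      ∀ (j : ℕ) (hj : j < m) (k : ℤ),
        w ⟨((k + j) % p).toNat, (hlt _).trans p.lt_succ_self⟩ ⟨0, hm⟩ =
          w ⟨(k % p).toNat, (hlt _).trans p.lt_succ_self⟩ ⟨j, hj⟩ := by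
    intro w hw hstep j
    induction j with
    | zero => intro hj k; simp
    | succ j ih =>
      intro hj k
      have h1 := ih (by omega) (k + 1)
      have h2 := (hstep ⟨(k % p).toNat, hlt k⟩).2 j hj
      have h3 : w (Fin.succ ⟨(k % p).toNat, hlt k⟩) =
          w ⟨((k + 1) % p).toNat, (hlt _).trans p.lt_succ_self⟩ := by
        have e0 := Int.emod_nonneg k hpz.ne'
        have e1 := hlt k
        rcases Nat.lt_or_ge ((k % p).toNat + 1) p with h | h
        · congr 1
          ext
          simp only [Fin.val_succ]
          have : (k + 1) % p = k % p + 1 := by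
            rw [← Int.emod_add_emod]
            exact Int.emod_eq_of_lt (by omega) (by omega)
          omega
        · have e2 : (k + 1) % p = 0 := by
            rw [← Int.emod_add_emod, show k % p + 1 = (p : ℤ) by omega, Int.emod_self]
          have e3 : Fin.succ ⟨(k % p).toNat, hlt k⟩ = Fin.last p := by
            ext; simp only [Fin.val_succ, Fin.val_last]; omega
          rw [e3, hw]
          congr 1
          ext
          simp [e2]
      rw [h3] at h2
      refine Eq.trans ?_ (h1.trans h2.symm)
      congr 3
      push_cast
      ring_nf
  rw [periodicCount, ← Set.ncard_coe_finset]
  change _ ≤ {x : ℤ → A | x ∈ X ∧ shiftMap^[p] x = x}.ncard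
  refine Set.ncard_le_ncard_of_injOn
    (fun w k => w ⟨(k % p).toNat, (hlt k).trans p.lt_succ_self⟩ ⟨0, hm⟩) ?_ ?_ hfin
  · intro w hw
    simp only [Finset.coe_filter, Finset.mem_univ, true_and, Set.mem_ofPred_eq] at hw
    refine ⟨hloc _ fun i => ?_, ?_⟩
    · convert (hw.2 ⟨(i % p).toNat, hlt i⟩).1 using 1
      funext j
      exact key w hw.1 hw.2 j j.2 i
    · rw [iterate_shiftMap_eq_self_iff]
      intro i
      simp
  · intro w hw w' hw' h
    simp only [Finset.coe_filter, Finset.mem_univ, true_and, Set.mem_ofPred_eq] at hw hw'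
    have hh : ∀ i : ℕ, ∀ hi : i < p, w ⟨i, by omega⟩ = w' ⟨i, by omega⟩ := by
      intro i hi
      funext j
      have e1 := key w hw.1 hw.2 j j.2 i
      have e2 := key w' hw'.1 hw'.2 j j.2 i
      have e3 := congrFun h (i + j : ℤ)
      have e4 : ((i : ℤ) % p).toNat = i := by
        rw [Int.emod_eq_of_lt (by omega) (by omega)]; simp
      simp only [e4] at e1 e2
      exact e1.symm.trans (e3.trans e2)
    funext ⟨i, hi⟩
    rcases Nat.lt_succ_iff_lt_or_eq.1 hi with h | rfl
    · exact hh i h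
    · exact hw.1.trans ((hh 0 hp).trans hw'.1.symm)

/-- At `t ≥ 1 / λ` the series defining the zeta function of an SFT of entropy `log λ` diverges. -/
theorem not_summable_periodicCount [Fintype A] {X : Set (ℤ → A)} (hSFT : IsSFT X)
    (hne : X.Nonempty) {lam : ℝ} (hlam : 1 ≤ lam)
    (hent : Tendsto (fun n : ℕ => Real.log ((wordsOf X n).ncard) / (n : ℝ))
      atTop (𝓝 (Real.log lam))) {t : ℝ} (ht : 1 / lam ≤ t) :
    ¬ Summable (fun p : ℕ => (periodicCount X (p + 1) : ℝ) / (p + 1) * t ^ (p + 1)) := by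
  obtain ⟨m, hm, hloc⟩ := hSFT.exists_length
  have hloc := hloc m le_rfl
  have hA : Nonempty A := ⟨hne.some 0⟩
  let M := relMatrix (WordStep X m)
  have hpos : ∀ n, 0 < (wordsOf X n).ncard := fun n => by
    rw [Set.ncard_pos (Set.toFinite _)]
    exact ⟨subword hne.some 0 n, hne.some, hne.some_mem, 0, fun j => rfl⟩
  obtain ⟨μ, hμ, hle⟩ := exists_eigenvalue_of_growth M (L := lam)
    (W := fun n => ((wordsOf X (n + m)).ncard : ℝ)) (fun n => by exact_mod_cast hpos _)
    (fun n => by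
      rw [sum_relMatrix_pow, Complex.norm_natCast]
      exact_mod_cast ncard_wordsOf_le_card_walks X hm n)
    (by
      have h1 := hent.comp (tendsto_add_atTop_nat m)
      have h2 : Tendsto (fun n : ℕ => 1 + (m : ℝ) / n) atTop (𝓝 (1 + 0)) :=
        tendsto_const_nhds.add (tendsto_const_div_atTop_nhds_zero_nat _)
      have h3 := h1.mul h2
      rw [add_zero, mul_one] at h3
      refine h3.congr' ?_
      filter_upwards [eventually_gt_atTop 0] with n hn
      have hn' : (0 : ℝ) < n := by exact_mod_cast hn
      simp only [Function.comp]
      push_cast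
      field_simp)
  obtain ⟨s, d, hd, hs, htr⟩ := trace_pow_eq_sum (Matrix.toLin' M)
  obtain ⟨ν, hν, hmax⟩ := s.exists_max_image (fun z => ‖z‖) ⟨μ, hs μ hμ⟩
  have hlν : lam ≤ ‖ν‖ := hle.trans (hmax μ (hs μ hμ))
  intro hsum
  have ht0 : 0 ≤ t := le_trans (by positivity) ht
  refine not_summable_of_eq_power_sum hd
    (a := fun p => ((Finset.univ.filter fun w : Fin (p + 1) → (Fin m → A) =>
      w (Fin.last p) = w 0 ∧ ∀ i : Fin p, WordStep X m (w i.castSucc) (w i.succ)).card : ℝ))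
    (fun p => Nat.cast_nonneg _) (fun p => ?_) hν ?_ hmax (t := t) ?_ ?_
  · rw [← htr p, ← Matrix.toLin'_pow, Matrix.trace_toLin'_eq, trace_relMatrix_pow]
    simp
  · exact norm_pos_iff.1 (by linarith)
  · exact (one_div_le_one_div_of_le (by linarith) hlν).trans ht
  · refine Summable.of_nonneg_of_le (fun p => by positivity) (fun p => ?_) hsum
    have := card_closed_walks_le_periodicCount hm hloc (Nat.succ_pos p)
    gcongr

end WordGraph

section EmptinessLimits

variable {A : Type*}

theorem summable_periodicCount_mul_pow [Finite A] {X : Set (ℤ → A)} {lam : ℝ} (hlam : 1 ≤ lam)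
    (hent : Tendsto (fun n : ℕ => Real.log ((wordsOf X n).ncard) / (n : ℝ))
      atTop (𝓝 (Real.log lam))) {t : ℝ} (h0 : 0 ≤ t) (ht : t < 1 / lam) :
    Summable (fun p : ℕ => (periodicCount X p : ℝ) * t ^ p) := by
  have hlam0 : 0 < lam := by linarith
  have ht' : t * lam < 1 := (lt_div_iff₀ hlam0).1 ht
  obtain ⟨β, hβ, hβt⟩ : ∃ β : ℝ, lam < β ∧ t * β < 1 := by
    have hcont : ∀ᶠ β in 𝓝[>] lam, t * β < 1 :=
      ((continuous_const.mul continuous_id).tendsto lam |>.eventually_lt_const ht').filter_mono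
        nhdsWithin_le_nhds
    obtain ⟨β, h1, h2⟩ := (hcont.and self_mem_nhdsWithin).exists
    exact ⟨β, h2, h1⟩
  have hβ0 : 0 < β := hlam0.trans hβ
  have hev : ∀ᶠ p : ℕ in atTop, (periodicCount X p : ℝ) * t ^ p ≤ (t * β) ^ p := by
    filter_upwards [hent.eventually_lt_const (Real.log_lt_log hlam0 hβ), eventually_gt_atTop 0]
      with p hp hp0
    have hp0' : (0 : ℝ) < p := by exact_mod_cast hp0
    rw [div_lt_iff₀ hp0', mul_comm, ← Real.log_pow] at hp
    have hB : ((wordsOf X p).ncard : ℝ) ≤ β ^ p := by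
      rcases Nat.eq_zero_or_pos (wordsOf X p).ncard with h | h
      · rw [h, Nat.cast_zero]; positivity
      · exact ((Real.log_lt_log_iff (by exact_mod_cast h) (by positivity)).1 hp).le
    rw [mul_pow, mul_comm]
    gcongr
    exact (Nat.cast_le.2 (periodicCount_le_ncard_wordsOf X hp0)).trans hB
  refine (summable_geometric_of_lt_one (by positivity) hβt).of_norm_bounded_eventually_nat ?_
  filter_upwards [hev] with p hp
  rwa [Real.norm_of_nonneg (by positivity)]

theorem bprob_empty_one [Fintype A] [DecidableEq A] {X : Set (ℤ → A)} (hne : X.Nonempty) (n : ℕ) :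
    bprob 1 {ω : (Fin n → A) → Bool | XRes X ω = ∅} = 0 := by
  refine Finset.sum_eq_zero fun ω _ => ?_
  split_ifs with h
  · obtain ⟨x, hx⟩ := hne
    have hx' : ¬ ∀ i, ω (subword x i n) = true := fun hω => by
      have : x ∈ XRes X ω := ⟨hx, hω⟩
      rw [show XRes X ω = ∅ from h] at this
      exact this
    push Not at hx'
    obtain ⟨i, hi⟩ := hx'
    have hcard : (Finset.univ.filter fun e => ω e = false).card ≠ 0 :=
      Finset.card_ne_zero_of_mem (a := subword x i n) (by simpa using hi)
    rw [sub_self, zero_pow hcard, mul_zero]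
  · rfl

end EmptinessLimits

/-- **Theorem 1.1 (Emptiness).**  Let `X` be a nonempty SFT with entropy
`h(X) = log λ`.  Let `ℰ_n` be the event that the random SFT `X_ω` (each word of
length `n` kept independently with probability `α`) is empty.  Then for
`α ∈ [0, 1/λ)` the probability of `ℰ_n` tends to `ζ_X(α)⁻¹`, and for
`α ∈ [1/λ, 1]` it tends to `0`. -/
theorem random_SFT_emptiness {A : Type*} [Fintype A] [DecidableEq A]
    (X : Set (ℤ → A)) (hSFT : IsSFT X) (hne : X.Nonempty)
    (lam : ℝ) (hlam : 1 ≤ lam)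
    (hent : Tendsto (fun n : ℕ => Real.log ((wordsOf X n).ncard) / (n : ℝ))
      atTop (𝓝 (Real.log lam)))
    (α : ℝ) (hα0 : 0 ≤ α) (hα1 : α ≤ 1) :
    (α < 1 / lam →
      Tendsto (fun n : ℕ => bprob α {ω : (Fin n → A) → Bool | XRes X ω = ∅})
        atTop (𝓝 (zetaX X α)⁻¹)) ∧
    (1 / lam ≤ α →
      Tendsto (fun n : ℕ => bprob α {ω : (Fin n → A) → Bool | XRes X ω = ∅})
        atTop (𝓝 0)) := by
  obtain ⟨m, -, hloc⟩ := hSFT.exists_length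
  constructor
  · intro hα
    have hα1' : α < 1 := hα.trans_le ((div_le_one (by linarith)).2 hlam)
    have hsum := summable_periodicCount_mul_pow hlam hent hα0 hα
    have hsum' : Summable
        (fun p : ℕ => (periodicCount X (p + 1) : ℝ) / (p + 1) * α ^ (p + 1)) := by
      refine Summable.of_nonneg_of_le (fun p => by positivity) (fun p => ?_)
        ((summable_nat_add_iff 1).2 hsum)
      gcongr
      exact div_le_self (by positivity) (by linarith [Nat.cast_nonneg (α := ℝ) p])
    have hprod := tendsto_orbitProd hSFT hα0 hα1' hsum'
    rw [Metric.tendsto_atTop] at hprod ⊢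
    intro ε hε
    obtain ⟨P₁, hP₁⟩ := hprod (ε / 2) (half_pos hε)
    obtain ⟨s, hs⟩ := summable_iff_vanishing_norm.1 hsum (ε / 2) (half_pos hε)
    obtain ⟨P₂, hP₂⟩ := s.bddAbove
    let P := max P₁ P₂
    refine ⟨max (P * P) m, fun n hn => ?_⟩
    have hPn : P * P ≤ n := (le_max_left _ _).trans hn
    have hlow := orbitProd_le_bprob_empty_add X hSFT hα0 hα1 P n hPn
      (hloc n ((le_max_right _ _).trans hn))
    have hup := bprob_empty_le_orbitProd X hSFT hα0 hα1 P n hPn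
    have htail := hs (Finset.Ioc P (Fintype.card (Fin n → A))) (by
      rw [Finset.disjoint_left]
      intro p hp hps
      have h1 := (Finset.mem_Ioc.1 hp).1
      have h2 := hP₂ hps
      have h3 : P₂ ≤ P := le_max_right _ _
      omega)
    have hclose := hP₁ P (le_max_left _ _)
    rw [Real.dist_eq, abs_lt] at hclose ⊢
    rw [Real.norm_eq_abs, abs_lt] at htail
    constructor <;> linarith
  · intro hα
    rcases hα1.eq_or_lt with rfl | hα1'
    · simp_rw [bprob_empty_one hne]
      exact tendsto_const_nhds
    · have hprod := tendsto_orbitProd_zero hSFT hα0 hα1'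
        (not_summable_periodicCount hSFT hne hlam hent hα)
      rw [Metric.tendsto_atTop] at hprod ⊢
      intro ε hε
      obtain ⟨P, hP⟩ := hprod ε hε
      refine ⟨P * P, fun n hn => ?_⟩
      have hup := bprob_empty_le_orbitProd X hSFT hα0 hα1 P n hn
      have hclose := hP P le_rfl
      have hnn := bprob_nonneg hα0 hα1 {ω : (Fin n → A) → Bool | XRes X ω = ∅}
      rw [Real.dist_eq, abs_lt] at hclose ⊢
      constructor <;> linarith
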